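/- For σ ∈ (0,1), θ > -σ, integers 1 ≤ k ≤ n and m ≥ 0, with Pitman–Yor weights V_{n,k} = (∏_{i=1}^{k-1}(θ+iσ))/(θ+1)_{n-1}, the Bayesian nonparametric analog of the Good–Toulmin estimator satisfies ∑_{i=0}^m (V_{n+m+1,k+i+1} / V_{n,k}) · σ^{-i} 𝒞(m,i;σ,-n+kσ) = ((θ+kσ)/(θ+n)) · (θ+n+σ)_m / (θ+n+1)_m, where 𝒞(m,i;σ,-n+kσ) = (1/i!) ∑_{r=0}^i (-1)^r C(i,r) (n - σ(r+k))_m. -/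

import Mathlib

/-- Rising factorial `(x)_n = x (x+1) ⋯ (x+n-1)`, with `(x)_0 = 1`. -/
noncomputable def risingFactorial (x : ℝ) : ℕ → ℝ
  | 0 => 1
  | n + 1 => risingFactorial x n * (x + n)

/-- Pitman–Yor weights `V_{n,k} = (∏_{i=1}^{k-1} (θ + iσ)) / (θ+1)_{n-1}`. -/
noncomputable def pyV (σ θ : ℝ) (n k : ℕ) : ℝ :=
  (∏ i ∈ Finset.Icc 1 (k - 1), (θ + i * σ)) / risingFactorial (θ + 1) (n - 1)

/-- Non-central generalized factorial coefficient
`𝒞(m,i;σ,-n+kσ) = (1/i!) ∑_{r=0}^i (-1)^r C(i,r) (n - σ(r+k))_m`. -/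
noncomputable def ncGenFactCoeff (σ : ℝ) (n k m i : ℕ) : ℝ :=
  (1 / (i.factorial : ℝ)) *
    ∑ r ∈ Finset.range (i + 1),
      (-1 : ℝ) ^ r * (i.choose r : ℝ) * risingFactorial ((n : ℝ) - σ * ((r : ℝ) + k)) m

lemma gt_coeff_succ_zero (σ : ℝ) (n k m : ℕ) :
    ncGenFactCoeff σ n k (m + 1) 0 = (n - σ * k + m) * ncGenFactCoeff σ n k m 0 := by
  simp [ncGenFactCoeff, risingFactorial]
  ring

lemma gt_coeff_succ (σ : ℝ) (n k m i : ℕ) :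
    ncGenFactCoeff σ n k (m + 1) (i + 1) =
      (n - σ * k + m - σ * (i + 1)) * ncGenFactCoeff σ n k m (i + 1)
        + σ * ncGenFactCoeff σ n k m i := by
  have hf : ((i + 1).factorial : ℝ) = (i + 1) * i.factorial := by
    rw [Nat.factorial_succ]; push_cast; ring
  have hi : (i.factorial : ℝ) ≠ 0 := by positivity
  have hi1 : ((i : ℝ) + 1) ≠ 0 := by positivity
  have key : ∑ r ∈ Finset.range (i + 1 + 1),
      (-1 : ℝ) ^ r * ((i + 1).choose r : ℝ) *
        risingFactorial ((n : ℝ) - σ * ((r : ℝ) + k)) (m + 1)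
      = (n - σ * k + m - σ * (i + 1)) * (∑ r ∈ Finset.range (i + 1 + 1),
      (-1 : ℝ) ^ r * ((i + 1).choose r : ℝ) *
        risingFactorial ((n : ℝ) - σ * ((r : ℝ) + k)) m)
      + σ * (i + 1) * (∑ r ∈ Finset.range (i + 1),
      (-1 : ℝ) ^ r * (i.choose r : ℝ) *
        risingFactorial ((n : ℝ) - σ * ((r : ℝ) + k)) m) := by
    have ext : ∑ r ∈ Finset.range (i + 1),
      (-1 : ℝ) ^ r * (i.choose r : ℝ) *
        risingFactorial ((n : ℝ) - σ * ((r : ℝ) + k)) m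
      = ∑ r ∈ Finset.range (i + 1 + 1),
      (-1 : ℝ) ^ r * (i.choose r : ℝ) *
        risingFactorial ((n : ℝ) - σ * ((r : ℝ) + k)) m := by
      rw [Finset.sum_range_succ _ (i + 1)]
      simp
    rw [ext, Finset.mul_sum, Finset.mul_sum, ← Finset.sum_add_distrib]
    refine Finset.sum_congr rfl fun r hr => ?_
    have hr' : r ≤ i + 1 := by simpa [Nat.lt_succ_iff] using hr
    have hc : ((i : ℝ) + 1 - r) * ((i + 1).choose r : ℝ) = (i + 1) * (i.choose r : ℝ) := by
      have h := Nat.choose_mul_succ_eq i r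
      have h2 : ((i + 1 - r : ℕ) : ℝ) = (i : ℝ) + 1 - r := by
        rw [Nat.cast_sub hr']; push_cast; ring
      rw [← h2]
      have h3 : ((i.choose r * (i + 1) : ℕ) : ℝ) = (((i + 1).choose r * (i + 1 - r) : ℕ) : ℝ) := by
        rw [h]
      push_cast [-Nat.cast_sub] at h3
      linarith
    simp only [risingFactorial]
    linear_combination σ * (-1 : ℝ) ^ r *
      risingFactorial ((n : ℝ) - σ * ((r : ℝ) + k)) m * hc
  unfold ncGenFactCoeff
  rw [key, hf]
  field_simp

lemma gt_coeff_vanish (σ : ℝ) (n k m : ℕ) : ∀ i, m < i → ncGenFactCoeff σ n k m i = 0 := by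
  induction m with
  | zero =>
    intro i hi
    have h := Int.alternating_sum_range_choose (n := i)
    rw [if_neg (by omega)] at h
    have h2 : ∑ r ∈ Finset.range (i + 1), (-1 : ℝ) ^ r * (i.choose r : ℝ) = 0 := by
      exact_mod_cast h
    simp [ncGenFactCoeff, risingFactorial, h2]
  | succ m ih =>
    intro i hi
    obtain ⟨j, rfl⟩ : ∃ j, i = j + 1 := ⟨i - 1, by omega⟩
    rw [gt_coeff_succ, ih _ (by omega), ih _ (by omega)]
    ring

lemma gt_sum (σ : ℝ) (n k m : ℕ) (b : ℝ) (w : ℕ → ℝ) (w0 : w 0 = 1)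
    (hw : ∀ i, σ * w (i + 1) = w i * (b + i * σ)) :
    ∑ i ∈ Finset.range (m + 1), w i * ncGenFactCoeff σ n k m i =
      risingFactorial (n - σ * k + b) m := by
  induction m with
  | zero => simp [w0, ncGenFactCoeff, risingFactorial]
  | succ m ih =>
    have e : ∑ i ∈ Finset.range (m + 1), w i * ncGenFactCoeff σ n k m i =
        ∑ i ∈ Finset.range (m + 1 + 1), w i * ncGenFactCoeff σ n k m i := by
      rw [Finset.sum_range_succ _ (m + 1), gt_coeff_vanish σ n k m (m + 1) (by omega)]
      simp
    have e2 : ∑ i ∈ Finset.range (m + 1 + 1), (n - σ * k + m - σ * i) *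
          (w i * ncGenFactCoeff σ n k m i) =
        ∑ i ∈ Finset.range (m + 1), (n - σ * k + m - σ * i) *
          (w i * ncGenFactCoeff σ n k m i) := by
      rw [Finset.sum_range_succ _ (m + 1), gt_coeff_vanish σ n k m (m + 1) (by omega)]
      simp
    have e3 : ∑ i ∈ Finset.range (m + 1 + 1), w i * ncGenFactCoeff σ n k (m + 1) i =
        ∑ i ∈ Finset.range (m + 1 + 1), (n - σ * k + m - σ * i) *
          (w i * ncGenFactCoeff σ n k m i) +
        ∑ i ∈ Finset.range (m + 1), (b + i * σ) * (w i * ncGenFactCoeff σ n k m i) := by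
      rw [Finset.sum_range_succ', Finset.sum_range_succ' _ (m + 1), gt_coeff_succ_zero,
        add_right_comm, ← Finset.sum_add_distrib]
      congr 1
      · refine Finset.sum_congr rfl fun i _ => ?_
        rw [gt_coeff_succ]
        push_cast
        linear_combination ncGenFactCoeff σ n k m i * hw i
      · push_cast
        ring
    rw [e3, e2, ← Finset.sum_add_distrib, risingFactorial, ← ih, Finset.sum_mul]
    refine Finset.sum_congr rfl fun i _ => ?_
    ring

lemma gt_prod (σ θ : ℝ) (k i : ℕ) :
    ∏ j ∈ Finset.Icc 1 (k + 1 + i), (θ + j * σ) =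
      (∏ j ∈ Finset.Icc 1 k, (θ + j * σ)) * (θ + (k + 1 : ℕ) * σ) *
        ∏ j ∈ Finset.range i, (θ + (k + 1 : ℕ) * σ + σ + j * σ) := by
  induction i with
  | zero => simp [Finset.prod_Icc_succ_top]
  | succ i ih =>
    rw [← add_assoc, Finset.prod_Icc_succ_top (by omega), ih, Finset.prod_range_succ]
    push_cast
    ring

lemma gt_rf (θ : ℝ) (n m : ℕ) :
    risingFactorial (θ + 1) (n + 1 + m) =
      risingFactorial (θ + 1) n * (θ + (n + 1 : ℕ)) *
        risingFactorial (θ + (n + 1 : ℕ) + 1) m := by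
  induction m with
  | zero =>
    simp only [risingFactorial, add_zero]
    push_cast
    ring
  | succ m ih =>
    rw [← add_assoc, risingFactorial, ih, risingFactorial]
    push_cast
    ring

lemma gt_rf_pos (x : ℝ) (hx : 0 < x) (n : ℕ) : 0 < risingFactorial x n := by
  induction n with
  | zero => simp [risingFactorial]
  | succ n ih => rw [risingFactorial]; positivity

/-- For `σ ∈ (0,1)`, `θ > -σ`, integers `1 ≤ k ≤ n` and `m ≥ 0`, the Bayesian
nonparametric analog of the Good–Toulmin estimator for the Pitman–Yor process satisfies
`∑_{i=0}^m (V_{n+m+1,k+i+1}/V_{n,k}) σ^{-i} 𝒞(m,i;σ,-n+kσ)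
  = ((θ+kσ)/(θ+n)) (θ+n+σ)_m / (θ+n+1)_m`. -/
theorem py_good_toulmin_estimator (σ θ : ℝ) (hσ0 : 0 < σ) (hσ1 : σ < 1)
    (hθ : θ > -σ) (n k m : ℕ) (hk : 1 ≤ k) (hkn : k ≤ n) :
    ∑ i ∈ Finset.range (m + 1),
        pyV σ θ (n + m + 1) (k + i + 1) / pyV σ θ n k * σ⁻¹ ^ i *
          ncGenFactCoeff σ n k m i =
      (θ + k * σ) / (θ + n) *
        (risingFactorial (θ + n + σ) m / risingFactorial (θ + n + 1) m) := by
  obtain ⟨k, rfl⟩ : ∃ j, k = j + 1 := ⟨k - 1, by omega⟩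
  obtain ⟨n, rfl⟩ : ∃ j, n = j + 1 := ⟨n - 1, by omega⟩
  have hθ1 : 0 < θ + 1 := by linarith
  have hn : 0 < θ + (n + 1 : ℕ) := by
    push_cast
    have : (0 : ℝ) ≤ n := by positivity
    linarith
  have hP : 0 < ∏ j ∈ Finset.Icc 1 k, (θ + j * σ) := by
    refine Finset.prod_pos fun j hj => ?_
    have : (1 : ℝ) ≤ j := by exact_mod_cast (Finset.mem_Icc.1 hj).1
    nlinarith
  have hR := gt_rf_pos (θ + 1) hθ1 n
  have hR2 := gt_rf_pos (θ + (n + 1 : ℕ) + 1) (by linarith) m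
  have hs := gt_sum σ (n + 1) (k + 1) m (θ + (k + 1 : ℕ) * σ + σ)
    (fun i => σ⁻¹ ^ i * ∏ j ∈ Finset.range i, (θ + (k + 1 : ℕ) * σ + σ + j * σ))
    (by simp) (fun i => by
      simp only [Finset.prod_range_succ, pow_succ]
      field_simp)
  have harg : ((n + 1 : ℕ) : ℝ) - σ * (k + 1 : ℕ) + (θ + (k + 1 : ℕ) * σ + σ) =
      θ + (n + 1 : ℕ) + σ := by ring
  rw [harg] at hs
  rw [← hs, Finset.sum_div, Finset.mul_sum]
  refine Finset.sum_congr rfl fun i _ => ?_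
  have h1 : k + 1 + i + 1 - 1 = k + 1 + i := by omega
  have h2 : n + 1 + m + 1 - 1 = n + 1 + m := by omega
  simp only [pyV, h1, h2, Nat.add_sub_cancel, gt_prod, gt_rf]
  generalize ∏ j ∈ Finset.range i, (θ + (k + 1 : ℕ) * σ + σ + j * σ) = Q
  generalize ncGenFactCoeff σ (n + 1) (k + 1) m i = C
  generalize ∏ j ∈ Finset.Icc 1 k, (θ + j * σ) = P at *
  generalize risingFactorial (θ + 1) n = R at *
  generalize risingFactorial (θ + (n + 1 : ℕ) + 1) m = R2 at *
  generalize θ + ((n + 1 : ℕ) : ℝ) = N at *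
  field_simp
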